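/- Let B_0,…,B_n ∈ 𝓕 be conditionally independent given 𝓖, set W := Σ_{i=0}^{n} 1_{B_i}, let H be a nonnegative version of E[W|𝓖], and let h_i be a version of ℙ[B_i|𝓖] for each i. Then for every A ⊆ ℕ the sharper bound |ℙ[{W ∈ A}|𝓖] − Po(A;H)| ≤ (max_{0≤i≤n} h_i)·(1 − e^{−H}) holds almost everywhere. -/

import Mathlib

open scoped BigOperators

/-- Poisson pmf: Po(k;lam) = lam^k * e^(-lam) / k!  (with the convention 0^0 = 1). -/
noncomputable def Po (k : ℕ) (lam : ℝ) : ℝ := lam ^ k * Real.exp (-lam) / (Nat.factorial k)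

/-- Poisson measure of a set A of naturals: Po(A;lam) = sum over k in A of Po(k;lam). -/
noncomputable def PoSet (A : Set ℕ) (lam : ℝ) : ℝ := ∑' k : A, Po k lam

/-- The scalar Stein-Chen solution g(j,lam,A), defined recursively by g(0,lam,A) = 0 and
g(j,lam,A) = lam⁻¹ * ((j-1)*g(j-1,lam,A) + 1_A(j-1) - Po(A;lam))
             + (1/j) * 1_{lam=0} * (1_A(0) - 1_A(j)) for j ≥ 1,
with the convention 0⁻¹ = 0. -/
noncomputable def steinChen : ℕ → ℝ → Set ℕ → ℝ
  | 0, _, _ => 0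
  | (j + 1), lam, A =>
      lam⁻¹ * ((j : ℝ) * steinChen j lam A
          + A.indicator (fun _ => (1 : ℝ)) j - PoSet A lam)
        + (1 / ((j : ℝ) + 1)) * (if lam = 0 then (1 : ℝ) else 0)
          * (A.indicator (fun _ => (1 : ℝ)) 0 - A.indicator (fun _ => (1 : ℝ)) (j + 1))

open MeasureTheory

/-- Expectation of `f W` for `W` the number of successes in independent trials indexed by `s` with
success probabilities `p`. -/
noncomputable def poissonBinomial {ι : Type*} [DecidableEq ι] (p : ι → ℝ) (s : Finset ι)
    (f : ℕ → ℝ) : ℝ :=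
  ∑ t ∈ s.powerset, (∏ i ∈ t, p i) * (∏ i ∈ s \ t, (1 - p i)) * f t.card

namespace poissonBinomial

variable {ι : Type*} [DecidableEq ι] (p : ι → ℝ)

lemma empty (f : ℕ → ℝ) : poissonBinomial p ∅ f = f 0 := by
  simp [poissonBinomial]

lemma insert {a : ι} {s : Finset ι} (ha : a ∉ s) (f : ℕ → ℝ) :
    poissonBinomial p (insert a s) f = (1 - p a) * poissonBinomial p s f
      + p a * poissonBinomial p s (fun j => f (j + 1)) := by
  unfold poissonBinomial
  rw [Finset.sum_powerset_insert ha, Finset.mul_sum, Finset.mul_sum]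
  congr 1
  · refine Finset.sum_congr rfl fun t ht => ?_
    have hat : a ∉ t := fun h => ha (Finset.mem_powerset.1 ht h)
    rw [Finset.insert_sdiff_of_notMem _ hat, Finset.prod_insert (by simp [ha])]
    ring
  · refine Finset.sum_congr rfl fun t ht => ?_
    have hat : a ∉ t := fun h => ha (Finset.mem_powerset.1 ht h)
    rw [Finset.insert_sdiff_insert, Finset.sdiff_insert_of_notMem ha, Finset.prod_insert hat,
      Finset.card_insert_of_notMem hat]
    ring

lemma abs_le {s : Finset ι} (hp : ∀ i ∈ s, 0 ≤ p i ∧ p i ≤ 1) {f : ℕ → ℝ} {C : ℝ}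
    (hf : ∀ j, |f j| ≤ C) : |poissonBinomial p s f| ≤ C := by
  induction s using Finset.induction_on generalizing f with
  | empty => simpa [empty] using hf 0
  | insert a s ha ih =>
    have hps : ∀ i ∈ s, 0 ≤ p i ∧ p i ≤ 1 := fun i hi => hp i (Finset.mem_insert_of_mem hi)
    have h1 := ih hps hf
    have h2 := ih hps (f := fun j => f (j + 1)) fun j => hf (j + 1)
    obtain ⟨h0, h0'⟩ := hp a (Finset.mem_insert_self a s)
    rw [insert p ha]
    rw [_root_.abs_le] at *
    constructor <;> nlinarith

lemma add (s : Finset ι) (f g : ℕ → ℝ) : poissonBinomial p s (fun j => f j + g j) =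
    poissonBinomial p s f + poissonBinomial p s g := by
  simp [poissonBinomial, mul_add, Finset.sum_add_distrib]

lemma sub (s : Finset ι) (f g : ℕ → ℝ) : poissonBinomial p s (fun j => f j - g j) =
    poissonBinomial p s f - poissonBinomial p s g := by
  simp [poissonBinomial, mul_sub, Finset.sum_sub_distrib]

lemma const_mul (s : Finset ι) (c : ℝ) (f : ℕ → ℝ) :
    poissonBinomial p s (fun j => c * f j) = c * poissonBinomial p s f := by
  simp only [poissonBinomial, Finset.mul_sum]
  exact Finset.sum_congr rfl fun _ _ => by ring

lemma const (s : Finset ι) (c : ℝ) : poissonBinomial p s (fun _ => c) = c := by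
  induction s using Finset.induction_on with
  | empty => simp [empty]
  | insert a s ha ih => rw [insert p ha, ih]; ring

lemma of_eq_zero {s : Finset ι} (hp : ∀ i ∈ s, p i = 0) (f : ℕ → ℝ) :
    poissonBinomial p s f = f 0 := by
  induction s using Finset.induction_on with
  | empty => simp [empty]
  | insert a s ha ih =>
    rw [insert p ha, ih fun i hi => hp i (Finset.mem_insert_of_mem hi),
      hp a (Finset.mem_insert_self a s)]
    ring

lemma natCast_mul (s : Finset ι) (f : ℕ → ℝ) : poissonBinomial p s (fun j => j * f j) =
    ∑ i ∈ s, p i * poissonBinomial p (s.erase i) (fun j => f (j + 1)) := by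
  induction s using Finset.induction_on generalizing f with
  | empty => simp [empty]
  | insert a s ha ih =>
    have hsucc : (fun j : ℕ => ((j + 1 : ℕ) : ℝ) * f (j + 1)) =
        fun j : ℕ => (j : ℝ) * f (j + 1) + f (j + 1) := by
      funext j; push_cast; ring
    rw [insert p ha, hsucc, add, ih f, ih fun j => f (j + 1), Finset.sum_insert ha,
      Finset.erase_insert ha, mul_add, Finset.mul_sum, Finset.mul_sum,
      show ∀ x y z w : ℝ, x + (y + z) = z + w ↔ x + y = w by intros; constructor <;> intro <;> linarith,
      ← Finset.sum_add_distrib]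
    refine Finset.sum_congr rfl fun i hi => ?_
    have hia : a ≠ i := fun h => ha (h ▸ hi)
    rw [Finset.erase_insert_of_ne hia, insert p fun h => ha (Finset.mem_of_mem_erase h)]
    ring

lemma stein (s : Finset ι) (f : ℕ → ℝ) :
    poissonBinomial p s (fun j => (∑ i ∈ s, p i) * f (j + 1) - j * f j) =
      ∑ i ∈ s, p i ^ 2 * poissonBinomial p (s.erase i) (fun j => f (j + 2) - f (j + 1)) := by
  rw [sub, const_mul, natCast_mul, Finset.sum_mul, ← Finset.sum_sub_distrib]
  refine Finset.sum_congr rfl fun i hi => ?_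
  conv_lhs => rw [← Finset.insert_erase hi, insert p (Finset.notMem_erase i s),
    Finset.erase_insert (Finset.notMem_erase i s)]
  rw [sub]
  ring

lemma abs_stein_le {s : Finset ι} (hp : ∀ i ∈ s, 0 ≤ p i ∧ p i ≤ 1) {M C : ℝ}
    (hM : ∀ i ∈ s, p i ≤ M) {f : ℕ → ℝ} (hf : ∀ j, |f (j + 2) - f (j + 1)| ≤ C) :
    |poissonBinomial p s (fun j => (∑ i ∈ s, p i) * f (j + 1) - j * f j)| ≤
      M * ((∑ i ∈ s, p i) * C) := by
  rw [stein, Finset.sum_mul, Finset.mul_sum]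
  refine (Finset.abs_sum_le_sum_abs _ _).trans (Finset.sum_le_sum fun i hi => ?_)
  have hC : 0 ≤ C := (abs_nonneg _).trans (hf 0)
  have h1 := abs_le p (s := s.erase i) (fun j hj => hp j (Finset.mem_of_mem_erase hj)) hf
  rw [abs_mul, abs_of_nonneg (sq_nonneg (p i))]
  calc p i ^ 2 * _ ≤ p i ^ 2 * C := by gcongr
    _ = p i * (p i * C) := by ring
    _ ≤ M * (p i * C) := mul_le_mul_of_nonneg_right (hM i hi) (mul_nonneg (hp i hi).1 hC)

end poissonBinomial

/-- Expectation of `a` under `q`, restricted to `{0, …, j - 1}` and centred by its full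
expectation: the numerator of the solution of the Stein equation. -/
noncomputable def steinNumerator (q a : ℕ → ℝ) (j : ℕ) : ℝ :=
  ∑ i ∈ Finset.range j, a i * q i - (∑' i, a i * q i) * ∑ i ∈ Finset.range j, q i

section SteinNumerator

variable {q a : ℕ → ℝ} {lam : ℝ}

lemma steinNumerator_succ_sub_le (hq : ∀ i, 0 ≤ q i) (hsum : HasSum q 1)
    (hrec : ∀ i : ℕ, ((i : ℝ) + 1) * q (i + 1) = lam * q i)
    (ha0 : ∀ i, 0 ≤ a i) (ha1 : ∀ i, a i ≤ 1) (j : ℕ) :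
    j * steinNumerator q a (j + 1) - lam * steinNumerator q a j ≤ j * (q j * (1 - q 0)) := by
  have haq : Summable fun i => a i * q i :=
    Summable.of_nonneg_of_le (fun i => mul_nonneg (ha0 i) (hq i))
      (fun i => mul_le_of_le_one_left (hq i) (ha1 i)) hsum.summable
  have hT := hsum.summable.sum_add_tsum_nat_add j
  have hT' := hsum.summable.sum_add_tsum_nat_add (j + 1)
  have hG := haq.sum_add_tsum_nat_add (j + 1)
  rw [hsum.tsum_eq] at hT hT'
  unfold steinNumerator
  have htail : (j : ℝ) * ∑' i, q (i + (j + 1)) ≤ lam * ∑' i, q (i + j) := by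
    have h1 := (summable_nat_add_iff (f := q) (j + 1)).2 hsum.summable
    have h2 := (summable_nat_add_iff (f := q) j).2 hsum.summable
    rw [← tsum_mul_left, ← tsum_mul_left]
    refine (h1.mul_left _).tsum_le_tsum (fun i => ?_) (h2.mul_left _)
    have := hrec (i + j)
    rw [← this, ← add_assoc]
    exact mul_le_mul_of_nonneg_right (by push_cast; nlinarith [Nat.cast_nonneg (α := ℝ) i]) (hq _)
  have hhead : lam * ∑ i ∈ Finset.range j, q i ≤
      j * (∑ i ∈ Finset.range (j + 1), q i - q 0) := by
    rw [Finset.sum_range_succ', add_sub_cancel_right, Finset.mul_sum, Finset.mul_sum]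
    refine Finset.sum_le_sum fun i hi => ?_
    rw [← hrec i]
    refine mul_le_mul_of_nonneg_right ?_ (hq _)
    exact_mod_cast Finset.mem_range.1 hi
  have hF0 : 0 ≤ ∑ i ∈ Finset.range j, a i * q i :=
    Finset.sum_nonneg fun i _ => mul_nonneg (ha0 i) (hq i)
  have hG0 : 0 ≤ ∑' i, a (i + (j + 1)) * q (i + (j + 1)) :=
    tsum_nonneg fun i => mul_nonneg (ha0 _) (hq _)
  rw [← hG]
  simp only [Finset.sum_range_succ _ j] at hhead hT' ⊢
  generalize ∑ i ∈ Finset.range j, a i * q i = F at *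
  generalize ∑ i ∈ Finset.range j, q i = S at *
  generalize ∑' i, a (i + (j + 1)) * q (i + (j + 1)) = G at *
  generalize ∑' i, q (i + (j + 1)) = T' at *
  generalize ∑' i, q (i + j) = T at *
  have hj : (0 : ℝ) ≤ j := Nat.cast_nonneg j
  have e1 : S = 1 - T := by linarith
  have e2 : T = T' + q j := by linarith
  have k1 := mul_nonneg hF0 (sub_nonneg.2 htail)
  have k2 := mul_nonneg hG0 (sub_nonneg.2 hhead)
  have k3 := mul_nonneg (mul_nonneg hG0 hj) (hq 0)
  have k4 := mul_nonneg (mul_nonneg (ha0 j) (hq j)) (sub_nonneg.2 hhead)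
  have hq0 : q 0 ≤ 1 := le_hasSum hsum 0 fun i _ => hq i
  have k5 := mul_nonneg (mul_nonneg (sub_nonneg.2 (ha1 j)) (hq j))
    (mul_nonneg hj (sub_nonneg.2 hq0))
  subst e2
  subst e1
  linear_combination k1 + k2 + k3 + k4 + k5

lemma abs_steinNumerator_succ_sub_le (hq : ∀ i, 0 ≤ q i) (hsum : HasSum q 1)
    (hrec : ∀ i : ℕ, ((i : ℝ) + 1) * q (i + 1) = lam * q i)
    (ha0 : ∀ i, 0 ≤ a i) (ha1 : ∀ i, a i ≤ 1) (j : ℕ) :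
    |j * steinNumerator q a (j + 1) - lam * steinNumerator q a j| ≤ j * (q j * (1 - q 0)) := by
  have haq : Summable fun i => a i * q i :=
    Summable.of_nonneg_of_le (fun i => mul_nonneg (ha0 i) (hq i))
      (fun i => mul_le_of_le_one_left (hq i) (ha1 i)) hsum.summable
  have hcompl : ∀ k, steinNumerator q (fun i => 1 - a i) k = -steinNumerator q a k := fun k => by
    simp only [steinNumerator, sub_mul, one_mul, hsum.summable.tsum_sub haq, hsum.tsum_eq,
      Finset.sum_sub_distrib]
    ring
  have h1 := steinNumerator_succ_sub_le hq hsum hrec ha0 ha1 j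
  have h2 := steinNumerator_succ_sub_le hq hsum hrec (a := fun i => 1 - a i)
    (fun i => sub_nonneg.2 (ha1 i)) (fun i => sub_le_self _ (ha0 i)) j
  rw [hcompl, hcompl] at h2
  exact abs_le.2 ⟨by linarith, h1⟩

/-- Existence of a solution of the Stein equation whose increments satisfy the Barbour–Eagleson
bound. -/
lemma exists_stein_solution (hq : ∀ i, 0 < q i) (hsum : HasSum q 1) (hlam : 0 < lam)
    (hrec : ∀ i : ℕ, ((i : ℝ) + 1) * q (i + 1) = lam * q i)
    (ha0 : ∀ i, 0 ≤ a i) (ha1 : ∀ i, a i ≤ 1) :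
    ∃ g : ℕ → ℝ, (∀ j : ℕ, lam * g (j + 1) - j * g j = a j - ∑' i, a i * q i) ∧
      ∀ j, |g (j + 2) - g (j + 1)| ≤ (1 - q 0) / lam := by
  refine ⟨fun j => steinNumerator q a j / (j * q j), fun j => ?_, fun j => ?_⟩
  · have h1 := (hq j).ne'
    have hl := hlam.ne'
    have e1 : lam * (steinNumerator q a (j + 1) / ((j + 1 : ℕ) * q (j + 1))) =
        steinNumerator q a (j + 1) / q j := by
      push_cast
      rw [hrec]
      field_simp
    have e2 : (j : ℝ) * (steinNumerator q a j / (j * q j)) = steinNumerator q a j / q j := by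
      rcases Nat.eq_zero_or_pos j with rfl | hj
      · simp [steinNumerator]
      · have : (j : ℝ) ≠ 0 := by positivity
        field_simp
    rw [e1, e2, ← sub_div, div_eq_iff h1]
    simp only [steinNumerator, Finset.sum_range_succ]
    ring
  · have h := abs_steinNumerator_succ_sub_le (fun i => (hq i).le) hsum hrec ha0 ha1 (j + 1)
    have hr := hrec (j + 1)
    have h1 := (hq (j + 1)).ne'
    have hl := hlam.ne'
    have hj : ((j + 1 : ℕ) : ℝ) ≠ 0 := by positivity
    have hpos : 0 < ((j + 1 : ℕ) : ℝ) * q (j + 1) * lam := by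
      have := hq (j + 1)
      positivity
    have e : steinNumerator q a (j + 2) / ((j + 2 : ℕ) * q (j + 2)) -
        steinNumerator q a (j + 1) / ((j + 1 : ℕ) * q (j + 1)) =
        ((j + 1 : ℕ) * steinNumerator q a (j + 1 + 1) - lam * steinNumerator q a (j + 1)) /
          ((j + 1 : ℕ) * q (j + 1) * lam) := by
      have : ((j + 2 : ℕ) : ℝ) * q (j + 2) = lam * q (j + 1) := by
        rw [← hr]; push_cast; ring_nf
      rw [this]
      field_simp
    rw [e, abs_div, abs_of_pos hpos, div_le_div_iff₀ hpos hlam]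
    calc _ ≤ _ := mul_le_mul_of_nonneg_right h hlam.le
      _ = _ := by ring

end SteinNumerator

lemma hasSum_Po (lam : ℝ) : HasSum (fun k => Po k lam) 1 := by
  have h := (NormedSpace.expSeries_div_hasSum_exp lam).mul_right (Real.exp (-lam))
  rw [← Real.exp_eq_exp_ℝ, ← Real.exp_add, add_neg_cancel, Real.exp_zero] at h
  refine h.congr_fun ?_
  intro k
  simp only [Po]
  ring

lemma succ_mul_Po_succ (lam : ℝ) (i : ℕ) : ((i : ℝ) + 1) * Po (i + 1) lam = lam * Po i lam := by
  have h1 : (i.factorial : ℝ) ≠ 0 := by positivity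
  have h2 : ((i : ℝ) + 1) ≠ 0 := by positivity
  simp only [Po, Nat.factorial_succ, Nat.cast_mul, Nat.cast_succ]
  field_simp
  ring

lemma PoSet_eq_tsum (A : Set ℕ) (lam : ℝ) :
    PoSet A lam = ∑' k, A.indicator (fun _ => (1 : ℝ)) k * Po k lam := by
  rw [PoSet, tsum_subtype A fun k => Po k lam]
  refine tsum_congr fun k => ?_
  by_cases hk : k ∈ A <;> simp [hk]

lemma PoSet_zero (A : Set ℕ) : PoSet A 0 = A.indicator (fun _ => (1 : ℝ)) 0 := by
  rw [PoSet_eq_tsum, tsum_eq_single 0 fun k hk => by simp [Po, hk]]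
  simp [Po]

theorem abs_poissonBinomial_sub_PoSet_le {ι : Type*} [DecidableEq ι] (p : ι → ℝ) {s : Finset ι}
    (hp : ∀ i ∈ s, 0 ≤ p i ∧ p i ≤ 1) {M : ℝ} (hM : ∀ i ∈ s, p i ≤ M) (A : Set ℕ) :
    |poissonBinomial p s (A.indicator fun _ => 1) - PoSet A (∑ i ∈ s, p i)| ≤
      M * (1 - Real.exp (-∑ i ∈ s, p i)) := by
  have hlam0 : 0 ≤ ∑ i ∈ s, p i := Finset.sum_nonneg fun i hi => (hp i hi).1
  rcases hlam0.eq_or_lt with h0 | hlam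
  · have hz := (Finset.sum_eq_zero_iff_of_nonneg fun i hi => (hp i hi).1).1 h0.symm
    rw [← h0, poissonBinomial.of_eq_zero p hz, PoSet_zero]
    simp
  obtain ⟨g, hg, hg'⟩ := exists_stein_solution (q := fun k => Po k (∑ i ∈ s, p i))
    (a := A.indicator fun _ => 1) (fun k => by simp only [Po]; positivity) (hasSum_Po _) hlam
    (succ_mul_Po_succ _) (fun k => Set.indicator_nonneg (fun _ _ => zero_le_one) k)
    (fun k => Set.indicator_le_self' (f := fun _ => (1 : ℝ)) (fun _ _ => zero_le_one) k)
  have h := poissonBinomial.abs_stein_le p hp hM hg'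
  simp only [hg, ← PoSet_eq_tsum] at h
  rw [poissonBinomial.sub, poissonBinomial.const, mul_div_cancel₀ _ hlam.ne'] at h
  simpa [Po] using h

open ProbabilityTheory in
lemma condExp_indicator_compl_ae_eq {Ω : Type*} {𝓖 mΩ : MeasurableSpace Ω} (h𝓖 : 𝓖 ≤ mΩ)
    (μ : Measure Ω) [IsProbabilityMeasure μ] {B : Set Ω} (hB : MeasurableSet B) :
    μ⟦Bᶜ | 𝓖⟧ =ᵐ[μ] fun ω => 1 - (μ⟦B | 𝓖⟧) ω := by
  have hfun : Bᶜ.indicator (fun _ => (1 : ℝ)) =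
      (fun _ => (1 : ℝ)) - B.indicator (fun _ => (1 : ℝ)) := by
    rw [Set.indicator_compl]
  rw [hfun]
  filter_upwards [condExp_sub (integrable_const (1 : ℝ))
    ((integrable_const (1 : ℝ)).indicator hB) 𝓖 (μ := μ)] with ω hω
  rw [hω, condExp_const h𝓖]
  rfl

open ProbabilityTheory in
/-- The conditional law of the number of conditionally independent events that occur is
Poisson binomial. -/
lemma condExp_card_ae_eq_poissonBinomial {Ω ι : Type*} [Fintype ι] [DecidableEq ι]
    {𝓖 : MeasurableSpace Ω} [mΩ : MeasurableSpace Ω] [StandardBorelSpace Ω] (h𝓖 : 𝓖 ≤ mΩ)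
    (μ : Measure Ω) [IsProbabilityMeasure μ] {B : ι → Set Ω} (hB : ∀ i, MeasurableSet (B i))
    (hind : iCondIndepSet 𝓖 h𝓖 B μ) (f : ℕ → ℝ) :
    μ[fun ω => f (∑ i, (B i).indicator (fun _ => (1 : ℕ)) ω) | 𝓖] =ᵐ[μ]
      fun ω => poissonBinomial (fun i => (μ⟦B i | 𝓖⟧) ω) Finset.univ f := by
  let D : Finset ι → ι → Set Ω := fun t i => if i ∈ t then B i else (B i)ᶜ
  have hD : ∀ t i, MeasurableSet (D t i) := fun t i => by
    by_cases hi : i ∈ t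
    · simpa [D, hi] using hB i
    · simpa [D, hi] using (hB i).compl
  have hDm : ∀ t, MeasurableSet (⋂ i ∈ (Finset.univ : Finset ι), D t i) := fun t =>
    Finset.measurableSet_biInter _ fun i _ => hD t i
  have hInt : ∀ t, Integrable ((⋂ i ∈ (Finset.univ : Finset ι), D t i).indicator
      fun _ => (1 : ℝ)) μ := fun t => (integrable_const _).indicator (hDm t)
  have hfun : (fun ω => f (∑ i, (B i).indicator (fun _ => (1 : ℕ)) ω)) =
      ∑ t ∈ (Finset.univ : Finset ι).powerset, f t.card •
        (⋂ i ∈ (Finset.univ : Finset ι), D t i).indicator fun _ => (1 : ℝ) := by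
    classical
    funext ω
    have hmem : ∀ t, ω ∈ (⋂ i ∈ (Finset.univ : Finset ι), D t i) ↔
        t = Finset.univ.filter fun i => ω ∈ B i := fun t => by
      simp only [Set.mem_iInter, Finset.mem_univ, true_implies, Finset.ext_iff,
        Finset.mem_filter, true_and]
      refine forall_congr' fun i => ?_
      by_cases hi : i ∈ t <;> simp [D, hi]
    simp only [Finset.sum_apply, Pi.smul_apply, smul_eq_mul, Set.indicator_apply, hmem]
    simp
  have hprod : ∀ t, μ⟦⋂ i ∈ (Finset.univ : Finset ι), D t i | 𝓖⟧ =ᵐ[μ]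
      ∏ i, (μ⟦D t i | 𝓖⟧) := fun t => by
    refine (iCondIndep_iff 𝓖 h𝓖 _ (fun i => ?_) μ).1
      ((iCondIndepSet_iff_iCondIndep 𝓖 h𝓖 B μ).1 hind) Finset.univ fun i _ => ?_
    · exact MeasurableSpace.generateFrom_le fun s hs => by
        rw [Set.mem_singleton_iff.1 hs]; exact hB i
    · have := MeasurableSpace.measurableSet_generateFrom (Set.mem_singleton (B i))
      by_cases hi : i ∈ t
      · simpa [D, hi] using this
      · simpa [D, hi] using this.compl
  rw [hfun]
  filter_upwards [condExp_finsetSum (fun t _ => (hInt t).smul (f t.card)) 𝓖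
      (s := (Finset.univ : Finset ι).powerset),
    ae_all_iff.2 fun t => condExp_smul (μ := μ) (f (Finset.card t))
      ((⋂ i ∈ (Finset.univ : Finset ι), D t i).indicator fun _ => (1 : ℝ)) 𝓖,
    ae_all_iff.2 hprod,
    ae_all_iff.2 fun i => condExp_indicator_compl_ae_eq h𝓖 μ (hB i)] with ω h1 h2 h3 h4
  rw [h1, Finset.sum_apply, poissonBinomial]
  refine Finset.sum_congr rfl fun t _ => ?_
  rw [h2, Pi.smul_apply, h3, Finset.prod_apply, smul_eq_mul, mul_comm]
  congr 1
  rw [← Finset.prod_sdiff (Finset.subset_univ t), mul_comm]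
  congr 1
  · exact Finset.prod_congr rfl fun i hi => by simp [D, hi]
  · refine Finset.prod_congr rfl fun i hi => ?_
    simp only [D, (Finset.mem_sdiff.1 hi).2, if_false]
    exact h4 i

/-- Sharper finite sum law of small numbers ((4.26) in the paper, scalar instance):
with the notation of the finite law of small numbers,
|P[{W ∈ A}|𝓖] - Po(A;H)| ≤ (max_i h_i) * (1 - e^(-H)) almost everywhere. -/
theorem lawOfSmallNumbers_finite_sharp
    {Ω : Type*} (𝓖 : MeasurableSpace Ω) [mΩ : MeasurableSpace Ω] [StandardBorelSpace Ω]
    (h𝓖 : 𝓖 ≤ mΩ)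
    (μ : Measure Ω) [IsProbabilityMeasure μ]
    (n : ℕ) (B : Fin (n + 1) → Set Ω) (hBmeas : ∀ i, MeasurableSet (B i))
    (hBindep : ProbabilityTheory.iCondIndepSet 𝓖 h𝓖 B μ)
    (W : Ω → ℕ) (hW : W = fun ω => ∑ i, (B i).indicator (fun _ => (1 : ℕ)) ω)
    (H : Ω → ℝ) (hH0 : ∀ ω, 0 ≤ H ω)
    (hH : H =ᵐ[μ] μ[fun ω => (W ω : ℝ) | 𝓖])
    (h : Fin (n + 1) → Ω → ℝ)
    (hh : ∀ i, h i =ᵐ[μ] μ[(B i).indicator (fun _ => (1 : ℝ)) | 𝓖])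
    (A : Set ℕ) :
    ∀ᵐ ω ∂μ,
      |(μ[Set.indicator {ω' | W ω' ∈ A} (fun _ => (1 : ℝ)) | 𝓖]) ω - PoSet A (H ω)|
        ≤ (⨆ i, h i ω) * (1 - Real.exp (-(H ω))) := by
  classical
  subst hW
  have hInt : ∀ i, Integrable ((B i).indicator fun _ => (1 : ℝ)) μ := fun i =>
    (integrable_const _).indicator (hBmeas i)
  have hWsum : (fun ω => ((∑ i, (B i).indicator (fun _ => (1 : ℕ)) ω : ℕ) : ℝ)) =
      ∑ i, (B i).indicator fun _ => (1 : ℝ) := by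
    funext ω
    simp [Set.indicator_apply]
  rw [hWsum] at hH
  have hle : ∀ i, μ[(B i).indicator (fun _ => (1 : ℝ)) | 𝓖] ≤ᵐ[μ] fun _ => 1 := fun i => by
    have := condExp_mono (m := 𝓖) (hInt i) (integrable_const (1 : ℝ))
      (Filter.Eventually.of_forall fun ω =>
        Set.indicator_le_self' (f := fun _ => (1 : ℝ)) (fun _ _ => zero_le_one) ω)
    rwa [condExp_const h𝓖] at this
  have hnonneg : ∀ i, 0 ≤ᵐ[μ] μ[(B i).indicator (fun _ => (1 : ℝ)) | 𝓖] := fun i =>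
    condExp_nonneg (Filter.Eventually.of_forall fun ω =>
      Set.indicator_nonneg (fun _ _ => zero_le_one) ω)
  filter_upwards [hH, condExp_finsetSum (fun i _ => hInt i) 𝓖 (s := Finset.univ),
    ae_all_iff.2 hh, ae_all_iff.2 hle, ae_all_iff.2 hnonneg,
    condExp_card_ae_eq_poissonBinomial h𝓖 μ hBmeas hBindep (A.indicator fun _ => 1)]
    with ω hHω hsum hhω h1 h0 hpb
  have hHsum : H ω = ∑ i, h i ω := by
    rw [hHω, hsum, Finset.sum_apply]
    exact Finset.sum_congr rfl fun i _ => (hhω i).symm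
  simp only [← hhω] at h0 h1 hpb
  have key := abs_poissonBinomial_sub_PoSet_le (fun i => h i ω) (s := Finset.univ)
    (fun i _ => ⟨h0 i, h1 i⟩) (M := ⨆ i, h i ω)
    (fun i _ => le_ciSup (f := fun i => h i ω) (Set.finite_range _).bddAbove i) A
  rw [← hHsum, ← hpb] at key
  exact key
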